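/- Let s ∈ (0,1) and a, b ∈ ℝ and set φ(x) = a(x_+)^s + b(x_+)^{1+s} on ℝ. Then for every h > 0, the function v(x) = φ(x+h) − φ(x) satisfies (−Δ)^s v = 0 in (0,∞). -/

import Mathlib

open MeasureTheory

/-- `φ_{a,b}(x) = a (x_+)^s + b (x_+)^{1+s}`. -/
noncomputable def phiAB (s a b : ℝ) (t : ℝ) : ℝ :=
  a * (max t 0) ^ s + b * (max t 0) ^ (1 + s)

lemma integrable_comp_abs_aux {f : ℝ → ℝ} (h : IntegrableOn f (Set.Ioi 0)) :
    Integrable (fun r : ℝ => f |r|) := by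
  rw [← integrableOn_univ, ← Set.Iic_union_Ioi (a := (0:ℝ))]
  have h2 : IntegrableOn (fun r : ℝ => f |r|) (Set.Ioi 0) :=
    h.congr_fun (fun r hr => by simp [abs_of_pos (Set.mem_Ioi.mp hr)]) measurableSet_Ioi
  refine IntegrableOn.union ?_ h2
  rw [integrableOn_Iic_iff_integrableOn_Iio]
  have := h2.comp_neg
  simpa using this
open Set Filter Topology

noncomputable def uu (s t : ℝ) : ℝ := (max t 0) ^ s

noncomputable def NN (s y r : ℝ) : ℝ := uu s (y + r) + uu s (y - r) - 2 * uu s y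

noncomputable def DD (s y r : ℝ) : ℝ := NN s y r / |r| ^ (1 + 2 * s)

lemma uu_mul (s y z : ℝ) (hy : 0 < y) : uu s (y * z) = y ^ s * uu s z := by
  unfold uu
  have : max (y * z) 0 = y * max z 0 := by
    rw [mul_max_of_nonneg _ _ hy.le, mul_zero]
  rw [this, Real.mul_rpow hy.le (le_max_right _ _)]

lemma NN_scale (s y r : ℝ) (hy : 0 < y) : NN s y (y * r) = y ^ s * NN s 1 r := by
  unfold NN
  have h1 : y + y * r = y * (1 + r) := by ring
  have h2 : y - y * r = y * (1 - r) := by ring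
  rw [h1, h2, uu_mul _ _ _ hy, uu_mul _ _ _ hy]
  have h3 : uu s y = y ^ s * uu s 1 := by
    rw [← uu_mul _ _ _ hy, mul_one]
  rw [h3]; ring

lemma NN_abs (s y r : ℝ) : NN s y |r| = NN s y r := by
  rcases abs_cases r with ⟨h, _⟩ | ⟨h, _⟩ <;> rw [h]
  unfold NN
  rw [sub_neg_eq_add, ← sub_eq_add_neg]; ring

lemma uu_of_nonneg (s : ℝ) {t : ℝ} (ht : 0 ≤ t) : uu s t = t ^ s := by
  unfold uu; rw [max_eq_left ht]

lemma uu_of_nonpos {s : ℝ} (hs : 0 < s) {t : ℝ} (ht : t ≤ 0) : uu s t = 0 := by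
  unfold uu; rw [max_eq_right ht, Real.zero_rpow hs.ne']

lemma NN_one_small {s t : ℝ} (hs0 : 0 < s) (hs1 : s < 1) (ht0 : 0 ≤ t) (ht1 : t ≤ 1) :
    |NN s 1 t| ≤ 2 * t ^ 2 := by
  unfold NN
  rw [uu_of_nonneg s (by linarith : 0 ≤ 1 + t), uu_of_nonneg s (by linarith : 0 ≤ 1 - t),
    uu_of_nonneg s zero_le_one, Real.one_rpow]
  have h1 := rpow_one_add_le_one_add_mul_self (s := t) (by linarith) hs0.le hs1.le
  have h2 := rpow_one_add_le_one_add_mul_self (s := -t) (by linarith) hs0.le hs1.le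
  rw [← sub_eq_add_neg] at h2
  have hA : 0 ≤ (1 + t) ^ s := Real.rpow_nonneg (by linarith) _
  have hB : 0 ≤ (1 - t) ^ s := Real.rpow_nonneg (by linarith) _
  have h3 : 1 - t ^ 2 ≤ (1 + t) ^ s * (1 - t) ^ s := by
    rw [← Real.mul_rpow (by linarith) (by linarith)]
    have : (1 + t) * (1 - t) = 1 - t ^ 2 := by ring
    rw [this]
    have h0 : 0 ≤ 1 - t ^ 2 := by nlinarith
    exact Real.self_le_rpow_of_le_one h0 (by nlinarith) hs1.le
  rw [abs_le]
  constructor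
  · by_contra hc
    push Not at hc
    have h0 : 0 ≤ 1 - t ^ 2 := by nlinarith
    have h5 : (1 + t) ^ s + (1 - t) ^ s < 2 * (1 - t ^ 2) := by linarith
    nlinarith [sq_nonneg ((1 + t) ^ s - (1 - t) ^ s)]
  · nlinarith

lemma NN_one_large {s t : ℝ} (hs0 : 0 < s) (hs1 : s < 1) (ht1 : 1 ≤ t) :
    |NN s 1 t| ≤ t ^ s := by
  unfold NN
  rw [uu_of_nonneg s (by linarith : 0 ≤ 1 + t), uu_of_nonpos hs0 (by linarith : 1 - t ≤ 0),
    uu_of_nonneg s zero_le_one, Real.one_rpow]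
  have h1 := Real.rpow_add_le_add_rpow zero_le_one (by linarith : 0 ≤ t) hs0.le hs1.le
  rw [Real.one_rpow] at h1
  have h2 : 1 ≤ t ^ s := Real.one_le_rpow ht1 hs0.le
  have h3 : 1 ≤ (1 + t) ^ s := Real.one_le_rpow (by linarith) hs0.le
  rw [abs_le]; constructor <;> linarith

lemma NN_one_bd {s t : ℝ} (hs0 : 0 < s) (hs1 : s < 1) (ht0 : 0 < t) :
    |NN s 1 t| ≤ 2 * t ^ (2:ℝ) ∧ |NN s 1 t| ≤ 2 * t ^ s := by
  rcases le_total t 1 with h | h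
  · have h1 := NN_one_small hs0 hs1 ht0.le h
    rw [← Real.rpow_two] at h1
    refine ⟨h1, h1.trans ?_⟩
    have := Real.rpow_le_rpow_of_exponent_ge ht0 h (by linarith : s ≤ 2)
    linarith
  · have h1 := NN_one_large hs0 hs1 h
    have := Real.rpow_le_rpow_of_exponent_le h (by linarith : s ≤ 2)
    have := Real.rpow_pos_of_pos ht0 s
    constructor <;> linarith

lemma NN_bd {s y r : ℝ} (hs0 : 0 < s) (hs1 : s < 1) (hy : 0 < y) (hr : 0 < r) :
    |NN s y r| ≤ 2 * y ^ (s - 2) * r ^ (2:ℝ) ∧ |NN s y r| ≤ 2 * r ^ s := by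
  have e : r = y * (r / y) := by field_simp
  have hd : 0 < r / y := by positivity
  have hN : |NN s y r| = y ^ s * |NN s 1 (r / y)| := by
    conv_lhs => rw [e, NN_scale _ _ _ hy, abs_mul, abs_of_pos (Real.rpow_pos_of_pos hy s)]
  have hys := Real.rpow_pos_of_pos hy s
  obtain ⟨h1, h2⟩ := NN_one_bd hs0 hs1 hd
  rw [hN]
  rw [Real.div_rpow hr.le hy.le] at h1 h2
  constructor
  · refine (mul_le_mul_of_nonneg_left h1 hys.le).trans (le_of_eq ?_)
    rw [Real.rpow_sub hy]
    ring
  · refine (mul_le_mul_of_nonneg_left h2 hys.le).trans (le_of_eq ?_)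
    field_simp

noncomputable def GG (s C r : ℝ) : ℝ := if r ≤ 1 then C * r ^ (1 - 2 * s) else 2 * r ^ (-1 - s)

lemma GG_int {s : ℝ} (hs0 : 0 < s) (hs1 : s < 1) (C : ℝ) :
    Integrable (fun r : ℝ => GG s C |r|) := by
  have h1 : IntegrableOn (GG s C) (Ioi 0) := by
    rw [← Ioc_union_Ioi_eq_Ioi zero_le_one]
    refine IntegrableOn.union ?_ ?_
    · have : IntegrableOn (fun r : ℝ => C * r ^ (1 - 2 * s)) (Ioc 0 1) :=
        ((intervalIntegral.intervalIntegrable_rpow' (a := 0) (b := 1)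
          (by linarith : -1 < 1 - 2 * s)).1).const_mul C
      refine this.congr_fun (fun r hr => ?_) measurableSet_Ioc
      simp [GG, hr.2]
    · have : IntegrableOn (fun r : ℝ => 2 * r ^ (-1 - s)) (Ioi 1) :=
        (integrableOn_Ioi_rpow_of_lt (by linarith) one_pos).const_mul 2
      refine this.congr_fun (fun r hr => ?_) measurableSet_Ioi
      simp [GG, not_le.mpr (mem_Ioi.mp hr)]
  exact integrable_comp_abs_aux h1

lemma DD_bd {s x y r : ℝ} (hs0 : 0 < s) (hs1 : s < 1) (hx : 0 < x) (hxy : x ≤ y) (hr0 : r ≠ 0) :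
    ‖DD s y r‖ ≤ GG s (2 * x ^ (s - 2)) |r| := by
  have hr : 0 < |r| := abs_pos.mpr hr0
  have hy : 0 < y := hx.trans_le hxy
  have hp := Real.rpow_pos_of_pos hr (1 + 2 * s)
  obtain ⟨h1, h2⟩ := NN_bd hs0 hs1 hy hr
  rw [NN_abs] at h1 h2
  unfold DD
  rw [norm_div, Real.norm_eq_abs, Real.norm_eq_abs, abs_of_pos hp]
  unfold GG
  split_ifs with h
  · rw [div_le_iff₀ hp, mul_assoc, ← Real.rpow_add hr]
    have h3 : y ^ (s - 2) ≤ x ^ (s - 2) :=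
      Real.rpow_le_rpow_of_nonpos hx hxy (by linarith)
    have h4 := Real.rpow_pos_of_pos hr 2
    have e : 1 - 2 * s + (1 + 2 * s) = 2 := by ring
    rw [e]
    exact h1.trans (by gcongr)
  · rw [div_le_iff₀ hp, mul_assoc, ← Real.rpow_add hr]
    have e : -1 - s + (1 + 2 * s) = s := by ring
    rwa [e]

lemma uu_cont {s : ℝ} (hs0 : 0 < s) : Continuous (uu s) := by
  unfold uu
  exact (continuous_id.max continuous_const).rpow_const (fun _ => Or.inr hs0.le)

lemma DD_meas {s : ℝ} (hs0 : 0 < s) : Measurable (fun p : ℝ × ℝ => DD s p.1 p.2) := by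
  have := (uu_cont hs0).measurable
  unfold DD NN
  fun_prop

lemma DD_int {s y : ℝ} (hs0 : 0 < s) (hs1 : s < 1) (hy : 0 < y) : Integrable (DD s y) := by
  refine (GG_int hs0 hs1 (2 * y ^ (s - 2))).mono' ?_ ?_
  · exact ((DD_meas hs0).comp (measurable_const.prodMk measurable_id) :
      Measurable (fun r => DD s y r)).aestronglyMeasurable
  · filter_upwards [compl_mem_ae_iff.mpr (measure_singleton (0:ℝ))] with r hr
    exact DD_bd hs0 hs1 hy le_rfl hr

noncomputable def AA (s r : ℝ) : ℝ := ((1 + r) ^ s - 1) * r ^ (-1 - 2 * s)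

noncomputable def BB (s r : ℝ) : ℝ := (uu s (1 - r) - 1) * r ^ (-1 - 2 * s)

noncomputable def GP (s r : ℝ) : ℝ := 1 / (2 * s) * (1 - (1 - r) ^ s) ^ 2 * r ^ (-2 * s)

lemma DD_eq_AB {s r : ℝ} (hr : 0 < r) : DD s 1 r = AA s r + BB s r := by
  unfold DD AA BB NN
  rw [abs_of_pos hr, uu_of_nonneg s (by linarith : 0 ≤ 1 + r), uu_of_nonneg s zero_le_one,
    Real.one_rpow, div_eq_mul_inv, ← Real.rpow_neg hr.le]
  have : -1 - 2 * s = -(1 + 2 * s) := by ring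
  rw [this]; ring

lemma AA_int {s ε : ℝ} (hs0 : 0 < s) (hs1 : s < 1) (hε : 0 < ε) : IntegrableOn (AA s) (Ioi ε) := by
  have h := integrableOn_Ioi_rpow_of_lt (by linarith : -1 - s < -1) hε
  refine Integrable.mono' h ?_ ?_
  · have : Measurable (AA s) := by unfold AA; fun_prop
    exact this.aestronglyMeasurable
  · refine (ae_restrict_mem measurableSet_Ioi).mono (fun r hr => ?_)
    have hr0 : 0 < r := hε.trans hr
    have h1 := Real.rpow_add_le_add_rpow zero_le_one hr0.le hs0.le hs1.le
    rw [Real.one_rpow] at h1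
    have h3 : 1 ≤ (1 + r) ^ s := Real.one_le_rpow (by linarith) hs0.le
    have hp := Real.rpow_pos_of_pos hr0 (-1 - 2 * s)
    unfold AA
    rw [Real.norm_eq_abs, abs_of_nonneg (mul_nonneg (by linarith) hp.le)]
    have e : -1 - s = s + (-1 - 2 * s) := by ring
    rw [e, Real.rpow_add hr0]
    gcongr
    linarith

lemma BB_int {s ε : ℝ} (hs0 : 0 < s) (hε : 0 < ε) : IntegrableOn (BB s) (Ioi ε) := by
  have h := integrableOn_Ioi_rpow_of_lt (by linarith : -1 - 2 * s < -1) hε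
  refine Integrable.mono' h ?_ ?_
  · have := (uu_cont hs0).measurable
    have : Measurable (BB s) := by unfold BB; fun_prop
    exact this.aestronglyMeasurable
  · refine (ae_restrict_mem measurableSet_Ioi).mono (fun r hr => ?_)
    have hr0 : 0 < r := hε.trans hr
    have hp := Real.rpow_pos_of_pos hr0 (-1 - 2 * s)
    have h1 : 0 ≤ uu s (1 - r) := Real.rpow_nonneg (le_max_right _ _) _
    have h2 : uu s (1 - r) ≤ 1 :=
      Real.rpow_le_one (le_max_right _ _) (max_le (by linarith) zero_le_one) hs0.le
    unfold BB
    rw [Real.norm_eq_abs, abs_mul, abs_of_pos hp, abs_of_nonpos (by linarith)]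
    nlinarith

lemma BB_one {s : ℝ} (hs0 : 0 < s) : ∫ r in Ioi (1:ℝ), BB s r = -(1 / (2 * s)) := by
  have : ∫ r in Ioi (1:ℝ), BB s r = ∫ r in Ioi (1:ℝ), -(r ^ (-1 - 2 * s)) := by
    refine setIntegral_congr_fun measurableSet_Ioi (fun r hr => ?_)
    have hr' : 1 < r := hr
    simp only [BB]
    rw [uu_of_nonpos hs0 (by linarith)]; ring
  rw [this, integral_neg, integral_Ioi_rpow_of_lt (by linarith) one_pos, Real.one_rpow]
  have : -1 - 2 * s + 1 = -(2 * s) := by ring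
  rw [this, neg_div_neg_eq]

lemma image_aux {ε : ℝ} (hε : 0 < ε) (hε1 : ε < 1) :
    (fun ρ : ℝ => ρ / (1 - ρ)) '' Ioo ε 1 = Ioi (ε / (1 - ε)) := by
  ext z
  simp only [mem_image, mem_Ioo, mem_Ioi]
  constructor
  · rintro ⟨ρ, ⟨h1, h2⟩, rfl⟩
    rw [div_lt_div_iff₀ (by linarith) (by linarith)]
    nlinarith
  · intro hz
    have hz0 : 0 < z := lt_trans (div_pos hε (by linarith)) hz
    rw [div_lt_iff₀ (by linarith)] at hz
    refine ⟨z / (1 + z), ⟨?_, ?_⟩, ?_⟩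
    · rw [lt_div_iff₀ (by linarith)]; nlinarith
    · rw [div_lt_one (by linarith)]; linarith
    · have : 1 - z / (1 + z) = 1 / (1 + z) := by field_simp; ring
      rw [this]; field_simp

lemma deriv_aux {ρ : ℝ} (h : ρ < 1) :
    HasDerivAt (fun ρ : ℝ => ρ / (1 - ρ)) (1 / (1 - ρ) ^ 2) ρ := by
  have h0 : 1 - ρ ≠ 0 := by linarith
  have := (hasDerivAt_id ρ).div ((hasDerivAt_id ρ).const_sub 1) h0
  refine this.congr_deriv ?_
  simp only [id]
  congr 1
  ring

lemma inj_aux (ε : ℝ) : InjOn (fun ρ : ℝ => ρ / (1 - ρ)) (Ioo ε 1) := by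
  intro p hp q hq h
  have h1 : 1 - p ≠ 0 := by linarith [hp.2]
  have h2 : 1 - q ≠ 0 := by linarith [hq.2]
  replace h : p / (1 - p) = q / (1 - q) := h
  rw [div_eq_div_iff h1 h2] at h
  linarith

noncomputable def AT (s ρ : ℝ) : ℝ := |1 / (1 - ρ) ^ 2| • AA s (ρ / (1 - ρ))

lemma AT_int {s ε : ℝ} (hs0 : 0 < s) (hs1 : s < 1) (hε : 0 < ε) (hε1 : ε < 1) :
    IntegrableOn (AT s) (Ioo ε 1) := by
  have h := integrableOn_image_iff_integrableOn_abs_deriv_smul (s := Ioo ε 1) measurableSet_Ioo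
    (fun ρ hρ => (deriv_aux hρ.2).hasDerivWithinAt) (inj_aux ε) (AA s)
  rw [image_aux hε hε1] at h
  exact h.mp (AA_int hs0 hs1 (div_pos hε (by linarith)))

lemma AT_integral {s ε : ℝ} (hε : 0 < ε) (hε1 : ε < 1) :
    ∫ r in Ioi (ε / (1 - ε)), AA s r = ∫ r in ε..1, AT s r := by
  have h := integral_image_eq_integral_abs_deriv_smul (s := Ioo ε 1) measurableSet_Ioo
    (fun ρ hρ => (deriv_aux hρ.2).hasDerivWithinAt) (inj_aux ε) (AA s)
  rw [image_aux hε hε1] at h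
  rw [h, intervalIntegral.integral_of_le hε1.le, integral_Ioc_eq_integral_Ioo]
  rfl

lemma GP_deriv {s ρ : ℝ} (hs0 : 0 < s) (h0 : 0 < ρ) (h1 : ρ < 1) :
    HasDerivAt (GP s) (AT s ρ + BB s ρ) ρ := by
  have hw : 0 < 1 - ρ := by linarith
  have d1 : HasDerivAt (fun r : ℝ => (1 - r) ^ s) (-1 * s * (1 - ρ) ^ (s - 1)) ρ :=
    ((hasDerivAt_id ρ).const_sub 1).rpow_const (Or.inl hw.ne')
  have d2 : HasDerivAt (fun r : ℝ => r ^ (-2 * s)) (-2 * s * ρ ^ (-2 * s - 1)) ρ :=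
    Real.hasDerivAt_rpow_const (Or.inl h0.ne')
  have d3 := (((d1.const_sub 1).pow 2).const_mul (1 / (2 * s))).mul d2
  refine HasDerivAt.congr_deriv (f := GP s) d3 ?_
  clear d1 d2 d3
  simp only [Pi.pow_apply]
  unfold AT AA BB
  have e1 : 1 + ρ / (1 - ρ) = (1 - ρ)⁻¹ := by field_simp; ring
  have hA : 0 < 1 / (1 - ρ) ^ 2 := by positivity
  rw [e1, abs_of_pos hA, uu_of_nonneg s hw.le, Real.div_rpow h0.le hw.le, Real.inv_rpow hw.le]
  have e2 : ρ ^ (-2 * s) = ρ ^ (-1 - 2 * s) * ρ := by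
    rw [← Real.rpow_add_one h0.ne']; congr 1; ring
  have e3 : -2 * s - 1 = -1 - 2 * s := by ring
  have e4 : (1 - ρ) ^ (s - 1) = (1 - ρ) ^ s / (1 - ρ) := Real.rpow_sub_one hw.ne' s
  have e5 : (1 - ρ) ^ (-1 - 2 * s) = ((1 - ρ) * ((1 - ρ) ^ s) ^ 2)⁻¹ := by
    have : -1 - 2 * s = -(1 + (s + s)) := by ring
    rw [this, Real.rpow_neg hw.le, Real.rpow_add hw, Real.rpow_add hw, Real.rpow_one]
    ring
  rw [e2, e3, e4, e5]
  have hW := Real.rpow_pos_of_pos hw s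
  simp only [smul_eq_mul]
  generalize (1 - ρ) ^ s = W at *
  generalize ρ ^ (-1 - 2 * s) = R at *
  have hs : s ≠ 0 := hs0.ne'
  have hw' := hw.ne'
  have hW' := hW.ne'
  clear e1 e2 e3 e4 e5 hA
  obtain ⟨w, hwρ⟩ : ∃ w, w = 1 - ρ := ⟨1 - ρ, rfl⟩
  have hρ : ρ = 1 - w := by rw [hwρ]; ring
  have hw0 : w ≠ 0 := by rw [hwρ]; exact hw'
  rw [← hwρ, hρ]
  push_cast
  field_simp
  ring

lemma GP_cont {s ε : ℝ} (hs0 : 0 < s) (hε : 0 < ε) : ContinuousOn (GP s) (Icc ε 1) := by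
  unfold GP
  refine ContinuousOn.mul (ContinuousOn.mul continuousOn_const (ContinuousOn.pow ?_ 2)) ?_
  · refine continuousOn_const.sub (Continuous.continuousOn ?_)
    exact (continuous_const.sub continuous_id).rpow_const (fun _ => Or.inr hs0.le)
  · exact continuousOn_id.rpow_const (fun r hr => Or.inl (hε.trans_le hr.1).ne')

lemma J_eq {s ε : ℝ} (hs0 : 0 < s) (hs1 : s < 1) (hε : 0 < ε) (hε1 : ε < 1) :
    ∫ r in Ioi ε, DD s 1 r = (∫ r in ε..(ε / (1 - ε)), AA s r) - GP s ε := by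
  have hle : ε ≤ ε / (1 - ε) := by
    rw [le_div_iff₀ (by linarith)]; nlinarith
  have h1 : ∫ r in Ioi ε, DD s 1 r = (∫ r in Ioi ε, AA s r) + ∫ r in Ioi ε, BB s r := by
    rw [← integral_add (AA_int hs0 hs1 hε) (BB_int hs0 hε)]
    exact setIntegral_congr_fun measurableSet_Ioi (fun r hr => DD_eq_AB (hε.trans hr))
  have h2 := intervalIntegral.integral_Ioi_sub_Ioi (AA_int hs0 hs1 hε) hle
  have h3 := intervalIntegral.integral_Ioi_sub_Ioi (BB_int hs0 hε) hε1.le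
  have iA : IntervalIntegrable (AT s) volume ε 1 := by
    rw [intervalIntegrable_iff_integrableOn_Ioo_of_le hε1.le]
    exact AT_int hs0 hs1 hε hε1
  have iB : IntervalIntegrable (BB s) volume ε 1 := by
    rw [intervalIntegrable_iff_integrableOn_Ioc_of_le hε1.le]
    exact (BB_int hs0 hε).mono_set Ioc_subset_Ioi_self
  have h4 := intervalIntegral.integral_eq_sub_of_hasDerivAt_of_le hε1.le (GP_cont hs0 hε)
    (fun ρ hρ => GP_deriv hs0 (hε.trans hρ.1) hρ.2) (iA.add iB)
  rw [intervalIntegral.integral_add iA iB] at h4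
  have h5 : GP s 1 = 1 / (2 * s) := by
    unfold GP
    rw [sub_self, Real.zero_rpow hs0.ne', Real.one_rpow]; ring
  rw [AT_integral hε hε1] at h2
  rw [BB_one hs0] at h3
  linarith

lemma J_bd {s ε : ℝ} (hs0 : 0 < s) (hs1 : s < 1) (hε : 0 < ε) (hε1 : ε < 1 / 2) :
    |∫ r in Ioi ε, DD s 1 r| ≤ (2 + 1 / (2 * s)) * ε ^ (2 - 2 * s) := by
  rw [J_eq hs0 hs1 hε (by linarith)]
  have hle : ε ≤ ε / (1 - ε) := by
    rw [le_div_iff₀ (by linarith)]; nlinarith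
  have hpow : ε ^ (2 - 2 * s) = ε ^ (-2 * s) * ε ^ 2 := by
    rw [← Real.rpow_two, ← Real.rpow_add hε]; congr 1; ring
  have hp := Real.rpow_pos_of_pos hε (-2 * s)
  have h1 : |∫ r in ε..(ε / (1 - ε)), AA s r| ≤ ε ^ (-2 * s) * |ε / (1 - ε) - ε| := by
    rw [← Real.norm_eq_abs]
    refine intervalIntegral.norm_integral_le_of_norm_le_const (fun r hr => ?_)
    rw [uIoc_of_le hle] at hr
    have hr0 : 0 < r := hε.trans hr.1
    have b1 := rpow_one_add_le_one_add_mul_self (s := r) (by linarith) hs0.le hs1.le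
    have b2 : 1 ≤ (1 + r) ^ s := Real.one_le_rpow (by linarith) hs0.le
    have b3 := Real.rpow_pos_of_pos hr0 (-1 - 2 * s)
    have b4 : r ^ (-2 * s) = r * r ^ (-1 - 2 * s) := by
      rw [mul_comm r, ← Real.rpow_add_one hr0.ne']; congr 1; ring
    have b5 : r ^ (-2 * s) ≤ ε ^ (-2 * s) :=
      Real.rpow_le_rpow_of_nonpos hε hr.1.le (by linarith)
    unfold AA
    rw [Real.norm_eq_abs, abs_of_nonneg (mul_nonneg (by linarith) b3.le)]
    refine le_trans ?_ b5
    rw [b4]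
    gcongr
    nlinarith
  have h2 : |ε / (1 - ε) - ε| ≤ 2 * ε ^ 2 := by
    rw [abs_of_nonneg (by linarith), sub_le_iff_le_add, div_le_iff₀ (by linarith)]
    nlinarith [sq_nonneg ε, pow_pos hε 3]
  have h3 : |GP s ε| ≤ 1 / (2 * s) * ε ^ 2 * ε ^ (-2 * s) := by
    have c1 : 1 - ε ≤ (1 - ε) ^ s :=
      Real.self_le_rpow_of_le_one (by linarith) (by linarith) hs1.le
    have c2 : (1 - ε) ^ s ≤ 1 := Real.rpow_le_one (by linarith) (by linarith) hs0.le
    unfold GP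
    rw [abs_of_nonneg (by positivity)]
    gcongr
    linarith
  calc _ ≤ |∫ r in ε..(ε / (1 - ε)), AA s r| + |GP s ε| := abs_sub _ _
    _ ≤ ε ^ (-2 * s) * (2 * ε ^ 2) + 1 / (2 * s) * ε ^ 2 * ε ^ (-2 * s) := by
        refine add_le_add (h1.trans ?_) h3
        gcongr
    _ = _ := by rw [hpow]; ring

lemma core_one {s : ℝ} (hs0 : 0 < s) (hs1 : s < 1) : ∫ r in Ioi (0:ℝ), DD s 1 r = 0 := by
  have hint : IntegrableOn (DD s 1) (Ioi 0) := (DD_int hs0 hs1 one_pos).integrableOn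
  have ht : Tendsto (fun ε : ℝ => ε) (𝓝[>] 0) (𝓝 0) := nhdsWithin_le_nhds
  have h1 := (aecover_Ioi_of_Ioi (μ := volume) ht).integral_tendsto_of_countably_generated hint
  refine tendsto_nhds_unique h1 ?_
  have h2 : Tendsto (fun ε : ℝ => (2 + 1 / (2 * s)) * ε ^ (2 - 2 * s)) (𝓝[>] 0) (𝓝 0) := by
    have : ContinuousAt (fun ε : ℝ => (2 + 1 / (2 * s)) * ε ^ (2 - 2 * s)) 0 :=
      (Real.continuousAt_rpow_const _ _ (Or.inr (by linarith))).const_mul _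
    have h := this.tendsto
    rw [Real.zero_rpow (by linarith), mul_zero] at h
    exact h.mono_left nhdsWithin_le_nhds
  refine squeeze_zero_norm' ?_ h2
  filter_upwards [Ioo_mem_nhdsGT (by norm_num : (0:ℝ) < 1 / 2)] with ε hε
  rw [Measure.restrict_restrict measurableSet_Ioi,
    inter_eq_left.mpr (Ioi_subset_Ioi hε.1.le)]
  exact J_bd hs0 hs1 hε.1 hε.2

lemma core {s y : ℝ} (hs0 : 0 < s) (hs1 : s < 1) (hy : 0 < y) : ∫ r, DD s y r = 0 := by
  have h1 : ∫ r, DD s 1 r = 0 := by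
    have e : ∫ r, DD s 1 r = ∫ r : ℝ, DD s 1 |r| := by
      refine integral_congr_ae (Eventually.of_forall (fun r => ?_))
      simp only [DD, NN_abs, abs_abs]
    rw [e, integral_comp_abs (f := DD s 1), core_one hs0 hs1, mul_zero]
  have h2 : ∀ r, DD s y (y * r) = (y ^ s / y ^ (1 + 2 * s)) * DD s 1 r := by
    intro r
    unfold DD
    rw [NN_scale _ _ _ hy, abs_mul, abs_of_pos hy, Real.mul_rpow hy.le (abs_nonneg r), mul_div_mul_comm]
  have h3 := Measure.integral_comp_mul_left (DD s y) y
  simp only [h2] at h3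
  rw [integral_const_mul, h1, mul_zero] at h3
  have : |y⁻¹| ≠ 0 := by simp [hy.ne']
  rcases smul_eq_zero.mp h3.symm with h | h
  · exact absurd h this
  · exact h

lemma uu_deriv {s : ℝ} (hs0 : 0 < s) (z : ℝ) :
    HasDerivAt (uu (1 + s)) ((1 + s) * uu s z) z := by
  have hne : ∀ y : ℝ, y ≠ 0 → HasDerivAt (uu (1 + s)) ((1 + s) * uu s y) y := by
    intro y hy
    rcases lt_or_gt_of_ne hy with h | h
    · rw [uu_of_nonpos hs0 h.le, mul_zero]
      refine (hasDerivAt_const y (0:ℝ)).congr_of_eventuallyEq ?_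
      filter_upwards [Iio_mem_nhds h] with t ht
      exact uu_of_nonpos (by linarith) (le_of_lt ht)
    · rw [uu_of_nonneg s h.le]
      have := Real.hasDerivAt_rpow_const (x := y) (p := 1 + s) (Or.inl h.ne')
      rw [add_sub_cancel_left] at this
      refine this.congr_of_eventuallyEq ?_
      filter_upwards [Ioi_mem_nhds h] with t ht
      exact uu_of_nonneg _ (le_of_lt ht)
  by_cases hz : z = 0
  · subst hz
    exact hasDerivAt_of_hasDerivAt_of_ne (g := fun z => (1 + s) * uu s z) hne
      (uu_cont (by linarith)).continuousAt ((uu_cont hs0).const_mul _).continuousAt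
  · exact hne z hz

lemma uu_ftc {s : ℝ} (hs0 : 0 < s) (y h : ℝ) :
    uu (1 + s) (y + h) - uu (1 + s) y = (1 + s) * ∫ t in (0:ℝ)..h, uu s (y + t) := by
  have hc : Continuous (fun t => (1 + s) * uu s (y + t)) :=
    ((uu_cont hs0).comp (continuous_const.add continuous_id)).const_mul _
  have := intervalIntegral.integral_eq_sub_of_hasDerivAt (a := 0) (b := h)
    (f := fun t => uu (1 + s) (y + t)) (f' := fun t => (1 + s) * uu s (y + t))
    (fun t _ => by
      have := (uu_deriv hs0 (y + t)).comp_const_add y t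
      exact this) (hc.intervalIntegrable _ _)
  rw [intervalIntegral.integral_const_mul, add_zero] at this
  exact this.symm

lemma diff_ftc {s : ℝ} (hs0 : 0 < s) (x h r : ℝ) :
    (NN (1 + s) (x + h) r - NN (1 + s) x r) / |r| ^ (1 + 2 * s)
      = (1 + s) * ∫ t in (0:ℝ)..h, DD s (x + t) r := by
  have c : ∀ y, IntervalIntegrable (fun t => uu s (y + t)) volume 0 h := fun y =>
    ((uu_cont hs0).comp (continuous_const.add continuous_id)).intervalIntegrable _ _
  have e : ∀ t, DD s (x + t) r
      = (uu s (x + r + t) + uu s (x - r + t) - 2 * uu s (x + t)) / |r| ^ (1 + 2 * s) := by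
    intro t
    unfold DD NN
    rw [add_right_comm x t r, add_sub_right_comm x t r]
  simp only [e]
  rw [intervalIntegral.integral_div, intervalIntegral.integral_sub ((c _).add (c _)) ((c _).const_mul 2),
    intervalIntegral.integral_add (c _) (c _), intervalIntegral.integral_const_mul, ← mul_div_assoc]
  congr 1
  have h1 := uu_ftc hs0 (x + r) h
  have h2 := uu_ftc hs0 (x - r) h
  have h3 := uu_ftc hs0 x h
  unfold NN
  rw [add_right_comm x h r, add_sub_right_comm x h r]
  linarith

lemma meas_aux {s : ℝ} (hs0 : 0 < s) (x : ℝ) :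
    Measurable (fun p : ℝ × ℝ => DD s (x + p.2) p.1) := by
  have := (uu_cont hs0).measurable
  unfold DD NN
  fun_prop

lemma fub {s x h : ℝ} (hs0 : 0 < s) (hs1 : s < 1) (hx : 0 < x) (hh : 0 < h) :
    Integrable (fun r : ℝ => ∫ t in (0:ℝ)..h, DD s (x + t) r) ∧
      ∫ r : ℝ, ∫ t in (0:ℝ)..h, DD s (x + t) r = 0 := by
  simp only [intervalIntegral.integral_of_le hh.le]
  have hI : Integrable (Function.uncurry (fun r t : ℝ => DD s (x + t) r))
      ((volume : Measure ℝ).prod (volume.restrict (Ioc 0 h))) := by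
    refine ((GG_int hs0 hs1 (2 * x ^ (s - 2))).comp_fst (volume.restrict (Ioc 0 h))).mono' ?_ ?_
    · have : Measurable (fun p : ℝ × ℝ => DD s (x + p.2) p.1) :=
        meas_aux hs0 x
      exact this.aestronglyMeasurable
    · have a0 : ∀ᵐ r : ℝ, r ≠ 0 := by
        filter_upwards [compl_mem_ae_iff.mpr (measure_singleton (0:ℝ))] with r hr
        exact hr
      have a1 : ∀ᵐ p : ℝ × ℝ ∂((volume : Measure ℝ).prod (volume.restrict (Ioc 0 h))), p.1 ≠ 0 :=
        Measure.quasiMeasurePreserving_fst.ae a0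
      have a2 : ∀ᵐ p : ℝ × ℝ ∂((volume : Measure ℝ).prod (volume.restrict (Ioc 0 h))),
          p.2 ∈ Ioc 0 h :=
        Measure.quasiMeasurePreserving_snd.ae (ae_restrict_mem measurableSet_Ioc)
      filter_upwards [a1, a2] with p h1 h2
      exact DD_bd hs0 hs1 hx (by linarith [h2.1]) h1
  refine ⟨hI.integral_prod_left, ?_⟩
  rw [integral_integral_swap hI]
  refine setIntegral_eq_zero_of_forall_eq_zero (fun t ht => ?_)
  exact core hs0 hs1 (by linarith [ht.1])

/-- For `φ(x) = a (x_+)^s + b (x_+)^{1+s}` and any `h > 0`, the increment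
`v = φ(·+h) - φ` satisfies `(-Δ)^s v = 0` in `(0,∞)` (second-difference form). -/
theorem stmt11 (s : ℝ) (hs0 : 0 < s) (hs1 : s < 1) (a b h : ℝ) (hh : 0 < h)
    (x : ℝ) (hx : 0 < x) :
    Integrable (fun r : ℝ =>
        ((phiAB s a b (x + r + h) - phiAB s a b (x + r)) +
          (phiAB s a b (x - r + h) - phiAB s a b (x - r)) -
          2 * (phiAB s a b (x + h) - phiAB s a b x)) / |r| ^ (1 + 2 * s)) ∧
      ∫ r : ℝ,
        ((phiAB s a b (x + r + h) - phiAB s a b (x + r)) +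
          (phiAB s a b (x - r + h) - phiAB s a b (x - r)) -
          2 * (phiAB s a b (x + h) - phiAB s a b x)) / |r| ^ (1 + 2 * s) = 0 := by
  have hphi : ∀ t, phiAB s a b t = a * uu s t + b * uu (1 + s) t := fun t => rfl
  have e : ∀ r : ℝ, ((phiAB s a b (x + r + h) - phiAB s a b (x + r)) +
          (phiAB s a b (x - r + h) - phiAB s a b (x - r)) -
          2 * (phiAB s a b (x + h) - phiAB s a b x)) / |r| ^ (1 + 2 * s)
      = a * (DD s (x + h) r - DD s x r)
        + b * ((1 + s) * ∫ t in (0:ℝ)..h, DD s (x + t) r) := by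
    intro r
    rw [← diff_ftc hs0]
    simp only [hphi, DD, NN]
    rw [add_right_comm x h r, add_sub_right_comm x h r]
    ring
  simp only [e]
  have i1 := DD_int hs0 hs1 (add_pos hx hh)
  have i2 := DD_int hs0 hs1 hx
  obtain ⟨i3, e3⟩ := fub hs0 hs1 hx hh
  have j1 := (i1.sub i2).const_mul a
  have j2 := (i3.const_mul (1 + s)).const_mul b
  refine ⟨j1.add j2, ?_⟩
  have k := integral_add j1 j2
  refine k.trans ?_
  rw [integral_const_mul, integral_const_mul, integral_const_mul, e3]
  have : ∫ r, (DD s (x + h) - DD s x) r = 0 := by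
    rw [integral_sub' i1 i2, core hs0 hs1 (add_pos hx hh), core hs0 hs1 hx, sub_zero]
  simp only [Pi.sub_apply] at this ⊢
  rw [this]; simp
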